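/- If for every integer k the Weyl averages (1/n) Σ_{j=0}^{n-1} e^{2πik·v(T^j x)} converge to some c_k ∈ ℂ, then there is a unique probability measure μ on the torus with Fourier coefficients c_k, and dim_FS(x) = Dim_FS(x) = H⁻(μ̂) = H⁺(μ̂), where μ̂ is the lift of μ to Cantor space. In particular x is a regular sequence. -/

import Mathlib

open MeasureTheory Filter Topology Real
open scoped ENNReal

noncomputable section

abbrev Cantor := ℕ → Bool

/-- `j`-fold left shift of a binary sequence. -/
def shiftk (x : Cantor) (j : ℕ) : Cantor := fun i => x (i + j)

/-- the left shift `T`. -/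
def Tshift (x : Cantor) : Cantor := fun i => x (i + 1)

/-- binary evaluation map `v`. -/
noncomputable def eval (x : Cantor) : ℝ := ∑' i : ℕ, if x i then ((2:ℝ) ^ (i + 1))⁻¹ else 0

noncomputable def negMulLog2 (p : ℝ) : ℝ := - p * Real.logb 2 p

/-- sliding count probability of a word `w` of length `l` in the prefix `x_0^{n-1}`. -/
noncomputable def slidingP (x : Cantor) (n l : ℕ) (w : Fin l → Bool) : ℝ :=
  (((Finset.range (n - l + 1)).filter (fun i => ∀ j : Fin l, x (i + (j : ℕ)) = w j)).card : ℝ)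
    / ((n - l + 1 : ℕ) : ℝ)

/-- sliding block entropy `H_l(x_0^{n-1})`. -/
noncomputable def slidingH (x : Cantor) (n l : ℕ) : ℝ :=
  (1 / (l : ℝ)) * ∑ w : Fin l → Bool, negMulLog2 (slidingP x n l w)

/-- disjoint block probability `P^d`. -/
noncomputable def disjP (x : Cantor) (n l : ℕ) (w : Fin l → Bool) : ℝ :=
  (((Finset.range (n / l)).filter (fun i => ∀ j : Fin l, x (l * i + (j : ℕ)) = w j)).card : ℝ)
    / ((n / l : ℕ) : ℝ)

/-- disjoint block entropy `H^d_l(x_0^{n-1})`. -/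
noncomputable def disjH (x : Cantor) (n l : ℕ) : ℝ :=
  (1 / (l : ℝ)) * ∑ w : Fin l → Bool, negMulLog2 (disjP x n l w)

/-- finite-state dimension via sliding block entropies. -/
noncomputable def dimFS (x : Cantor) : ℝ :=
  ⨅ l : ℕ, Filter.liminf (fun n => slidingH x n (l + 1)) Filter.atTop

/-- finite-state strong dimension. -/
noncomputable def DimFS (x : Cantor) : ℝ :=
  ⨅ l : ℕ, Filter.limsup (fun n => slidingH x n (l + 1)) Filter.atTop

/-- cylinder set. -/
def Cyl (l : ℕ) (w : Fin l → Bool) : Set Cantor := {y | ∀ j : Fin l, y (j : ℕ) = w j}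

/-- empirical measures `ν_n = n⁻¹ ∑_{j<n} δ_{T^j x}` on Cantor space. -/
noncomputable def empMeas (x : Cantor) (n : ℕ) : Measure Cantor :=
  (n : ℝ≥0∞)⁻¹ • ∑ j ∈ Finset.range n, Measure.dirac (shiftk x j)

/-- weak convergence of a sequence of measures. -/
def WeakConv {α : Type*} [TopologicalSpace α] [MeasurableSpace α]
    (ν : ℕ → Measure α) (μ : Measure α) : Prop :=
  ∀ f : BoundedContinuousFunction α ℂ,
    Tendsto (fun n => ∫ y, f y ∂(ν n)) atTop (nhds (∫ y, f y ∂μ))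

/-- block entropy `H_n(μ)` of a measure on Cantor space. -/
noncomputable def measH (μ : Measure Cantor) (n : ℕ) : ℝ :=
  ∑ w : Fin n → Bool, negMulLog2 ((μ (Cyl n w)).toReal)

/-- lower average entropy. -/
noncomputable def Hminus (μ : Measure Cantor) : ℝ :=
  Filter.liminf (fun n => measH μ n / n) Filter.atTop

/-- upper average entropy. -/
noncomputable def Hplus (μ : Measure Cantor) : ℝ :=
  Filter.limsup (fun n => measH μ n / n) Filter.atTop

/-- set of subsequence weak limits of the empirical measures of `x`. -/
def Wx (x : Cantor) : Set (Measure Cantor) :=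
  {μ | IsProbabilityMeasure μ ∧
      ∃ φ : ℕ → ℕ, StrictMono φ ∧ (∀ m, 0 < φ m) ∧
        WeakConv (fun m => empMeas x (φ m)) μ}

/-- normality of a binary sequence. -/
def IsNormal (x : Cantor) : Prop :=
  ∀ (l : ℕ) (w : Fin l → Bool),
    Tendsto (fun n => slidingP x n l w) atTop (nhds (((2:ℝ) ^ l)⁻¹))

/-- Weyl averages `(1/n) ∑_{j<n} e^{2πik v(T^j x)}`. -/
noncomputable def weylAvg (x : Cantor) (k : ℤ) (n : ℕ) : ℂ :=
  (n : ℂ)⁻¹ * ∑ j ∈ Finset.range n,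
    Complex.exp (2 * (Real.pi : ℂ) * Complex.I * (k : ℂ) * ((eval (shiftk x j) : ℝ) : ℂ))

/-- Weyl averages on the torus, `(1/n) ∑_{j<n} e^{2πik 2^j r}`. -/
noncomputable def weylAvgT (r : ℝ) (k : ℤ) (n : ℕ) : ℂ :=
  (n : ℂ)⁻¹ * ∑ j ∈ Finset.range n,
    Complex.exp (2 * (Real.pi : ℂ) * Complex.I * (k : ℂ) * (((2:ℝ) ^ j * r : ℝ) : ℂ))

/-- empirical measures `(1/n) ∑_{j<n} δ_{2^j r mod 1}` on the torus. -/
noncomputable def empMeasT (r : ℝ) (n : ℕ) : Measure UnitAddCircle :=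
  (n : ℝ≥0∞)⁻¹ • ∑ j ∈ Finset.range n, Measure.dirac (((2:ℝ) ^ j * r : ℝ) : UnitAddCircle)

/-- dyadic interval `[j/2^k, (j+1)/2^k)` on the torus. -/
def dyadicI (k j : ℕ) : Set UnitAddCircle :=
  (fun t : ℝ => (t : UnitAddCircle)) '' Set.Ico ((j : ℝ) / 2 ^ k) (((j : ℝ) + 1) / 2 ^ k)

/-- a real number is a dyadic rational. -/
def IsDyadic (t : ℝ) : Prop := ∃ (a : ℤ) (n : ℕ), t = (a : ℝ) / 2 ^ n

/-- value of a finite binary word. -/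
noncomputable def val2 (l : ℕ) (w : Fin l → Bool) : ℝ :=
  ∑ j : Fin l, if w j then ((2:ℝ) ^ ((j : ℕ) + 1))⁻¹ else 0

/-- dyadic interval `I_w` on the torus. -/
def IwT (l : ℕ) (w : Fin l → Bool) : Set UnitAddCircle :=
  (fun t : ℝ => (t : UnitAddCircle)) '' Set.Ico (val2 l w) (val2 l w + ((2:ℝ) ^ l)⁻¹)

/-- value of a finite base-`m` word. -/
noncomputable def valm (m n : ℕ) (w : Fin n → Fin m) : ℝ :=
  ∑ j : Fin n, ((w j : ℕ) : ℝ) / (m : ℝ) ^ ((j : ℕ) + 1)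

/-- base-`m` interval `I^m_w` on the torus. -/
def ImT (m n : ℕ) (w : Fin n → Fin m) : Set UnitAddCircle :=
  (fun t : ℝ => (t : UnitAddCircle)) '' Set.Ico (valm m n w) (valm m n w + ((m : ℝ) ^ n)⁻¹)

/-- base-`m` partition entropy `H^m_n(μ)` (natural logarithm). -/
noncomputable def measHT (μ : Measure UnitAddCircle) (m n : ℕ) : ℝ :=
  ∑ w : Fin n → Fin m, Real.negMulLog ((μ (ImT m n w)).toReal)

/-- lower Rényi dimension w.r.t. partition factor `m`. -/
noncomputable def renyiLower (μ : Measure UnitAddCircle) (m : ℕ) : ℝ :=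
  Filter.liminf (fun n => measHT μ m n / (n * Real.log m)) Filter.atTop

/-- upper Rényi dimension w.r.t. partition factor `m`. -/
noncomputable def renyiUpper (μ : Measure UnitAddCircle) (m : ℕ) : ℝ :=
  Filter.limsup (fun n => measHT μ m n / (n * Real.log m)) Filter.atTop

/-! ### entropy of consistent families -/

theorem wcc_nml_eq (p : ℝ) : negMulLog2 p = Real.negMulLog p / Real.log 2 := by
  unfold negMulLog2 Real.negMulLog Real.logb; ring

theorem wcc_nml_nonneg {p : ℝ} (h0 : 0 ≤ p) (h1 : p ≤ 1) : 0 ≤ negMulLog2 p := by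
  rw [wcc_nml_eq]
  exact div_nonneg (Real.negMulLog_nonneg h0 h1) (Real.log_nonneg (by norm_num))

theorem wcc_nml_le_one {p : ℝ} (h0 : 0 ≤ p) (h1 : p ≤ 1) : negMulLog2 p ≤ 2 := by
  rw [wcc_nml_eq]
  have hl : 0.5 < Real.log 2 := by linarith [Real.log_two_gt_d9]
  rw [div_le_iff₀ (by linarith)]
  have : Real.negMulLog p ≤ 1 - p := by
    rcases h0.eq_or_lt with rfl | hp
    · simp
    · have := Real.one_sub_inv_le_log_of_pos hp
      unfold Real.negMulLog
      have h2 : p * (1 - p⁻¹) ≤ p * Real.log p := mul_le_mul_of_nonneg_left this h0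
      have h3 : p * (1 - p⁻¹) = p - 1 := by field_simp
      linarith
  linarith

theorem wcc_nml_cont : Continuous negMulLog2 := by
  have : negMulLog2 = fun p => Real.negMulLog p / Real.log 2 := funext wcc_nml_eq
  rw [this]
  exact Real.continuous_negMulLog.div_const _

/-- Gibbs type inequality: joint entropy is at most the sum of the marginal entropies. -/
theorem wcc_joint {α β : Type*} [Fintype α] [Fintype β] (r : α → β → ℝ) (p : α → ℝ) (q : β → ℝ)
    (hr : ∀ a b, 0 ≤ r a b) (hp : ∀ a, ∑ b, r a b = p a) (hq : ∀ b, ∑ a, r a b = q b)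
    (h1 : ∑ a, p a = 1) :
    ∑ a, ∑ b, negMulLog2 (r a b) ≤ ∑ a, negMulLog2 (p a) + ∑ b, negMulLog2 (q b) := by
  have hq1 : ∑ b, q b = 1 := by
    rw [← h1]; simp_rw [← hp, ← hq]; exact Finset.sum_comm
  have hp0 : ∀ a, 0 ≤ p a := fun a => by rw [← hp]; exact Finset.sum_nonneg fun b _ => hr a b
  have hq0 : ∀ b, 0 ≤ q b := fun b => by rw [← hq]; exact Finset.sum_nonneg fun a _ => hr a b
  have key : ∀ a b, Real.negMulLog (r a b) ≤
      - r a b * Real.log (p a) - r a b * Real.log (q b) + (p a * q b - r a b) := by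
    intro a b
    rcases (hr a b).eq_or_lt with h | h
    · rw [← h]; simp; exact mul_nonneg (hp0 a) (hq0 b)
    · have hpa : 0 < p a := h.trans_le (by
        rw [← hp]; exact Finset.single_le_sum (fun b _ => hr a b) (Finset.mem_univ b))
      have hqb : 0 < q b := h.trans_le (by
        rw [← hq]; exact Finset.single_le_sum (f := fun a => r a b) (fun a _ => hr a b) (Finset.mem_univ a))
      have := Real.log_le_sub_one_of_pos (x := p a * q b / r a b) (by positivity)
      rw [Real.log_div (by positivity) h.ne', Real.log_mul hpa.ne' hqb.ne'] at this
      have h2 := mul_le_mul_of_nonneg_left this h.le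
      have h3 : r a b * (p a * q b / r a b - 1) = p a * q b - r a b := by field_simp
      unfold Real.negMulLog
      nlinarith
  simp_rw [wcc_nml_eq, ← Finset.sum_div]
  rw [← add_div]
  apply div_le_div_of_nonneg_right _ (Real.log_nonneg (by norm_num))
  calc ∑ a, ∑ b, Real.negMulLog (r a b) ≤ ∑ a, ∑ b,
        (- r a b * Real.log (p a) - r a b * Real.log (q b) + (p a * q b - r a b)) :=
        Finset.sum_le_sum fun a _ => Finset.sum_le_sum fun b _ => key a b
    _ = ∑ a, Real.negMulLog (p a) + ∑ b, Real.negMulLog (q b) := by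
        have e1 : ∑ a, ∑ b, - r a b * Real.log (p a) = ∑ a, Real.negMulLog (p a) := by
          refine Finset.sum_congr rfl fun a _ => ?_
          rw [← Finset.sum_mul, Finset.sum_neg_distrib, hp]; rfl
        have e2 : ∑ a, ∑ b, r a b * Real.log (q b) = - ∑ b, Real.negMulLog (q b) := by
          rw [Finset.sum_comm, ← Finset.sum_neg_distrib]
          refine Finset.sum_congr rfl fun b _ => ?_
          rw [← Finset.sum_mul, hq]; unfold Real.negMulLog; ring
        have e3 : ∑ a, ∑ b, p a * q b = 1 := by
          simp_rw [← Finset.mul_sum]; rw [hq1]; simpa using h1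
        have e4 : ∑ a, ∑ b, r a b = 1 := by simp_rw [hp]; exact h1
        simp_rw [Finset.sum_add_distrib, Finset.sum_sub_distrib]
        rw [e1, e2, e3, e4]; ring

/-- A shift-invariant consistent family of word probabilities. -/
structure WccFam (p : ∀ l, (Fin l → Bool) → ℝ) : Prop where
  nonneg : ∀ l w, 0 ≤ p l w
  one : ∀ l, ∑ w, p l w = 1
  suff : ∀ l m w, ∑ u : Fin m → Bool, p (l + m) (Fin.append w u) = p l w
  pref : ∀ l m w, ∑ u : Fin l → Bool, p (l + m) (Fin.append u w) = p m w

def wccE (p : ∀ l, (Fin l → Bool) → ℝ) (l : ℕ) : ℝ := ∑ w, negMulLog2 (p l w)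

theorem WccFam.le_one {p : ∀ l, (Fin l → Bool) → ℝ} (h : WccFam p) (l w) : p l w ≤ 1 := by
  rw [← h.one l]
  exact Finset.single_le_sum (fun w _ => h.nonneg l w) (Finset.mem_univ w)

theorem WccFam.E_nonneg {p : ∀ l, (Fin l → Bool) → ℝ} (h : WccFam p) (l) : 0 ≤ wccE p l :=
  Finset.sum_nonneg fun w _ => wcc_nml_nonneg (h.nonneg l w) (h.le_one l w)

theorem WccFam.sub {p : ∀ l, (Fin l → Bool) → ℝ} (h : WccFam p) : Subadditive (wccE p) := by
  intro l m
  have := wcc_joint (fun (a : Fin l → Bool) (b : Fin m → Bool) => p (l + m) (Fin.append a b))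
    (p l) (p m) (fun a b => h.nonneg _ _) (fun a => h.suff l m a) (fun b => h.pref l m b) (h.one l)
  refine le_trans (le_of_eq ?_) this
  unfold wccE
  rw [← Fintype.sum_prod_type' (f := fun a b => negMulLog2 (p (l + m) (Fin.append a b)))]
  exact (Equiv.sum_comp (Fin.appendEquiv l m) fun w => negMulLog2 (p (l + m) w)).symm

theorem WccFam.lim {p : ∀ l, (Fin l → Bool) → ℝ} (h : WccFam p) :
    ∃ L, Tendsto (fun n : ℕ => wccE p n / n) atTop (𝓝 L) ∧
      ∀ n : ℕ, n ≠ 0 → L ≤ wccE p n / n := by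
  have hb : BddBelow (Set.range fun n : ℕ => wccE p n / n) :=
    ⟨0, by rintro _ ⟨n, rfl⟩; exact div_nonneg (h.E_nonneg n) (Nat.cast_nonneg n)⟩
  exact ⟨h.sub.lim, h.sub.tendsto_lim hb, fun n hn => h.sub.lim_le_div hb hn⟩
/-! ### frequencies -/

open Classical in
def wccInd (x : Cantor) (l : ℕ) (w : Fin l → Bool) (i : ℕ) : ℝ :=
  if ∀ j : Fin l, x (i + (j : ℕ)) = w j then 1 else 0

def wccFreq (x : Cantor) (n l : ℕ) (w : Fin l → Bool) : ℝ :=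
  (∑ i ∈ Finset.range n, wccInd x l w i) / (n : ℝ)

theorem wccInd_eq (x : Cantor) (l : ℕ) (w : Fin l → Bool) (i : ℕ) :
    wccInd x l w i = if (fun j : Fin l => x (i + (j : ℕ))) = w then 1 else 0 := by
  unfold wccInd
  simp only [funext_iff]

theorem wcc_slidingP (x : Cantor) (n l : ℕ) (w : Fin l → Bool) :
    slidingP x n l w = wccFreq x (n - l + 1) l w := by
  unfold slidingP wccFreq wccInd
  congr 1
  rw [Finset.sum_boole]

theorem wccInd_nonneg (x : Cantor) (l : ℕ) (w : Fin l → Bool) (i : ℕ) : 0 ≤ wccInd x l w i := by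
  unfold wccInd; split_ifs <;> norm_num

theorem wccInd_le (x : Cantor) (l : ℕ) (w : Fin l → Bool) (i : ℕ) : wccInd x l w i ≤ 1 := by
  unfold wccInd; split_ifs <;> norm_num

theorem wccFreq_mem (x : Cantor) (n l : ℕ) (w : Fin l → Bool) :
    wccFreq x n l w ∈ Set.Icc (0 : ℝ) 1 := by
  unfold wccFreq
  refine ⟨div_nonneg (Finset.sum_nonneg fun i _ => wccInd_nonneg _ _ _ _) (Nat.cast_nonneg _), ?_⟩
  apply div_le_one_of_le₀ _ (Nat.cast_nonneg _)
  calc _ ≤ ∑ i ∈ Finset.range n, (1 : ℝ) := Finset.sum_le_sum fun i _ => wccInd_le _ _ _ _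
    _ = n := by simp

theorem wccFreq_one (x : Cantor) {n : ℕ} (hn : n ≠ 0) (l : ℕ) : ∑ w, wccFreq x n l w = 1 := by
  unfold wccFreq
  rw [← Finset.sum_div, Finset.sum_comm]
  have : ∀ i, ∑ w, wccInd x l w i = 1 := fun i => by
    simp_rw [wccInd_eq]; rw [Finset.sum_ite_eq]; simp
  simp_rw [this]; simp [hn]

theorem wccInd_append (x : Cantor) (l m : ℕ) (w : Fin l → Bool) (u : Fin m → Bool) (i : ℕ) :
    wccInd x (l + m) (Fin.append w u) i = wccInd x l w i * wccInd x m u (i + l) := by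
  have : (∀ j : Fin (l + m), x (i + (j : ℕ)) = Fin.append w u j) ↔
      (∀ j : Fin l, x (i + (j : ℕ)) = w j) ∧ ∀ j : Fin m, x (i + l + (j : ℕ)) = u j := by
    rw [Fin.forall_fin_add]
    simp [add_assoc]
  unfold wccInd
  by_cases h1 : ∀ j : Fin l, x (i + (j : ℕ)) = w j <;>
  by_cases h2 : ∀ j : Fin m, x (i + l + (j : ℕ)) = u j <;>
  simp only [this, h1, h2, and_self, and_false, false_and, and_true, true_and] <;> simp

theorem wccInd_sum (x : Cantor) (l : ℕ) (i : ℕ) : ∑ w, wccInd x l w i = 1 := by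
  simp_rw [wccInd_eq]; rw [Finset.sum_ite_eq]; simp

theorem wccFreq_suff (x : Cantor) (n l m : ℕ) (w : Fin l → Bool) :
    ∑ u : Fin m → Bool, wccFreq x n (l + m) (Fin.append w u) = wccFreq x n l w := by
  unfold wccFreq
  rw [← Finset.sum_div, Finset.sum_comm]
  simp_rw [wccInd_append, ← Finset.mul_sum, wccInd_sum, mul_one]

theorem wccFreq_pref (x : Cantor) (n l m : ℕ) (w : Fin m → Bool) :
    |∑ u : Fin l → Bool, wccFreq x n (l + m) (Fin.append u w) - wccFreq x n m w| ≤ l / n := by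
  unfold wccFreq
  rw [← Finset.sum_div, Finset.sum_comm]
  simp_rw [wccInd_append, ← Finset.sum_mul, wccInd_sum, one_mul]
  rw [← sub_div, abs_div, Nat.abs_cast]
  apply div_le_div_of_nonneg_right _ (Nat.cast_nonneg n)
  have h1 := Finset.sum_range_add (fun i => wccInd x m w i) l n
  have h2 := Finset.sum_range_add (fun i => wccInd x m w i) n l
  rw [add_comm n l] at h2
  have h3 : ∀ k, ∑ i ∈ Finset.range l, wccInd x m w (k + i) ∈ Set.Icc (0 : ℝ) l := fun k => by
    refine ⟨Finset.sum_nonneg fun i _ => wccInd_nonneg _ _ _ _, ?_⟩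
    calc _ ≤ ∑ i ∈ Finset.range l, (1 : ℝ) := Finset.sum_le_sum fun i _ => wccInd_le _ _ _ _
      _ = l := by simp
  have a := h3 0
  have b := h3 n
  simp only [zero_add] at a
  simp_rw [add_comm _ l]
  rw [abs_le]
  constructor <;> linarith [a.1, a.2, b.1, b.2]

/-- limits of the frequencies along an ultrafilter -/
def wccQ (x : Cantor) (U : Ultrafilter ℕ) (l : ℕ) (w : Fin l → Bool) : ℝ :=
  limUnder (U : Filter ℕ) (fun n => wccFreq x n l w)

theorem wccQ_tendsto (x : Cantor) (U : Ultrafilter ℕ) (l : ℕ) (w : Fin l → Bool) :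
    Tendsto (fun n => wccFreq x n l w) U (𝓝 (wccQ x U l w)) := by
  apply tendsto_nhds_limUnder
  obtain ⟨a, -, ha⟩ := (isCompact_Icc (a := (0:ℝ)) (b := 1)).ultrafilter_le_nhds
    (U.map fun n => wccFreq x n l w) (by
      simp only [le_principal_iff]
      exact Filter.Eventually.of_forall (f := (U : Filter ℕ)) fun n => wccFreq_mem x n l w)
  exact ⟨a, ha⟩

theorem wccQ_fam (x : Cantor) (U : Ultrafilter ℕ) (hU : (U : Filter ℕ) ≤ atTop) :
    WccFam (wccQ x U) where
  nonneg l w := ge_of_tendsto' (wccQ_tendsto x U l w) fun n => (wccFreq_mem x n l w).1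
  one l := by
    have h := tendsto_finsetSum Finset.univ fun w _ => wccQ_tendsto x U l w
    refine tendsto_nhds_unique h (tendsto_const_nhds.congr' ?_)
    filter_upwards [hU (eventually_ne_atTop 0)] with n hn using (wccFreq_one x hn l).symm
  suff l m w := by
    have h := tendsto_finsetSum Finset.univ fun u (_ : u ∈ Finset.univ) =>
      wccQ_tendsto x U (l + m) (Fin.append w u)
    refine tendsto_nhds_unique h ((wccQ_tendsto x U l w).congr fun n => ?_)
    exact (wccFreq_suff x n l m w).symm
  pref l m w := by
    have h := (tendsto_finsetSum Finset.univ fun u (_ : u ∈ Finset.univ) =>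
      wccQ_tendsto x U (l + m) (Fin.append u w)).sub (wccQ_tendsto x U m w)
    have h0 : Tendsto (fun n : ℕ => (l : ℝ) / n) U (𝓝 0) :=
      (tendsto_const_div_atTop_nhds_zero_nat (l : ℝ)).mono_left hU
    have := squeeze_zero_norm (f := fun n : ℕ => ∑ u : Fin l → Bool,
      wccFreq x n (l + m) (Fin.append u w) - wccFreq x n m w) (fun n => by
        rw [Real.norm_eq_abs]; exact wccFreq_pref x n l m w) h0
    exact sub_eq_zero.1 (tendsto_nhds_unique h this)

def wccH (x : Cantor) (l n : ℕ) : ℝ := ∑ w : Fin l → Bool, negMulLog2 (wccFreq x n l w)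

theorem wccH_tendsto (x : Cantor) (U : Ultrafilter ℕ) (l : ℕ) :
    Tendsto (wccH x l) U (𝓝 (wccE (wccQ x U) l)) :=
  tendsto_finsetSum _ fun w _ => (wcc_nml_cont.tendsto _).comp (wccQ_tendsto x U l w)

theorem wccH_nonneg (x : Cantor) (l n : ℕ) : 0 ≤ wccH x l n :=
  Finset.sum_nonneg fun w _ => wcc_nml_nonneg (wccFreq_mem x n l w).1 (wccFreq_mem x n l w).2

theorem wccH_le (x : Cantor) (l n : ℕ) : wccH x l n ≤ ∑ w : Fin l → Bool, 2 :=
  Finset.sum_le_sum fun w _ => wcc_nml_le_one (wccFreq_mem x n l w).1 (wccFreq_mem x n l w).2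

theorem wcc_slidingH_map (x : Cantor) (l : ℕ) :
    Filter.map (fun n => slidingH x n l) atTop =
      Filter.map (fun n => wccH x l n / l) atTop := by
  have : (fun n => slidingH x n l) = (fun n => wccH x l n / l) ∘ (fun n => n + 1) ∘ (fun n => n - l) := by
    funext n
    simp only [slidingH, wccH, Function.comp, wcc_slidingP]
    ring
  rw [this, ← Filter.map_map, ← Filter.map_map, Filter.map_sub_atTop_eq_nat,
    Filter.map_add_atTop_eq_nat]

/-- the abstract conclusion -/
theorem wcc_abstract (x : Cantor) (ν : Measure Cantor) [IsProbabilityMeasure ν]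
    (hc : ∀ U : Ultrafilter ℕ, (U : Filter ℕ) ≤ atTop → ∀ (l : ℕ) (w : Fin l → Bool),
      (∃ j, w j = true) → (∃ j, w j = false) → wccQ x U l w = (ν (Cyl l w)).toReal) :
    dimFS x = DimFS x ∧ dimFS x = Hminus ν ∧ Hminus ν = Hplus ν := by
  have hdiff : ∀ U : Ultrafilter ℕ, (U : Filter ℕ) ≤ atTop → ∀ l : ℕ,
      |wccE (wccQ x U) l - measH ν l| ≤ 8 := by
    intro U hU l
    unfold wccE measH
    rw [← Finset.sum_sub_distrib]
    have hz : ∀ w ∈ (Finset.univ : Finset (Fin l → Bool)),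
        w ∉ ({fun _ => true, fun _ => false} : Finset (Fin l → Bool)) →
        negMulLog2 (wccQ x U l w) - negMulLog2 (ν (Cyl l w)).toReal = 0 := by
      intro w _ hw
      simp only [Finset.mem_insert, Finset.mem_singleton, not_or, funext_iff, not_forall,
        Bool.not_eq_true, Bool.not_eq_false] at hw
      rw [hc U hU l w hw.2 hw.1, sub_self]
    rw [← Finset.sum_subset (Finset.subset_univ _) hz]
    refine (Finset.abs_sum_le_sum_abs _ _).trans ?_
    calc _ ≤ ∑ w ∈ ({fun _ => true, fun _ => false} : Finset (Fin l → Bool)), (4 : ℝ) := by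
          refine Finset.sum_le_sum fun w _ => ?_
          have F := wccQ_fam x U hU
          have a1 := wcc_nml_nonneg (F.nonneg l w) (F.le_one l w)
          have a2 := wcc_nml_le_one (F.nonneg l w) (F.le_one l w)
          have hν : (ν (Cyl l w)).toReal ≤ 1 := ENNReal.toReal_le_of_le_ofReal zero_le_one (by
            simpa using prob_le_one)
          have b1 := wcc_nml_nonneg ENNReal.toReal_nonneg hν
          have b2 := wcc_nml_le_one ENNReal.toReal_nonneg hν
          rw [abs_le]; constructor <;> linarith
      _ ≤ 8 := by
          rw [Finset.sum_const, nsmul_eq_mul]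
          have : (({fun _ => true, fun _ => false} : Finset (Fin l → Bool)).card : ℝ) ≤ 2 := by
            exact_mod_cast Finset.card_le_two
          linarith
  have h8 : Tendsto (fun n : ℕ => (8 : ℝ) / n) atTop (𝓝 0) :=
    tendsto_const_div_atTop_nhds_zero_nat 8
  have hlim : ∀ U : Ultrafilter ℕ, (U : Filter ℕ) ≤ atTop → ∃ L,
      Tendsto (fun n : ℕ => measH ν n / n) atTop (𝓝 L) ∧
        ∀ n : ℕ, n ≠ 0 → L ≤ wccE (wccQ x U) n / n := by
    intro U hU
    obtain ⟨L, hL, hL2⟩ := (wccQ_fam x U hU).lim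
    refine ⟨L, ?_, hL2⟩
    have : Tendsto (fun n : ℕ => wccE (wccQ x U) n / n - measH ν n / n) atTop (𝓝 0) := by
      refine squeeze_zero_norm (fun n => ?_) h8
      rw [← sub_div, norm_div, Real.norm_eq_abs, Real.norm_natCast]
      exact div_le_div_of_nonneg_right (hdiff U hU n) (Nat.cast_nonneg n)
    simpa using hL.sub this
  obtain ⟨L, hL, -⟩ := hlim (Ultrafilter.of atTop) (Ultrafilter.of_le atTop)
  have hge : ∀ U : Ultrafilter ℕ, (U : Filter ℕ) ≤ atTop → ∀ n : ℕ, n ≠ 0 →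
      L ≤ wccE (wccQ x U) n / n := by
    intro U hU n hn
    obtain ⟨L', h1, h2⟩ := hlim U hU
    rw [tendsto_nhds_unique hL h1]; exact h2 n hn
  have hm : Hminus ν = L := hL.liminf_eq
  have hp : Hplus ν = L := hL.limsup_eq
  have e1 : ∀ l : ℕ, liminf (fun n => slidingH x n l) atTop = liminf (fun n => wccH x l n / l) atTop :=
    fun l => by unfold liminf; rw [wcc_slidingH_map]
  have e2 : ∀ l : ℕ, limsup (fun n => slidingH x n l) atTop = limsup (fun n => wccH x l n / l) atTop :=
    fun l => by unfold limsup; rw [wcc_slidingH_map]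
  have bb : ∀ l : ℕ, IsBoundedUnder (· ≥ ·) atTop (fun n => wccH x l n / l) := fun l =>
    isBoundedUnder_of ⟨0, fun n => div_nonneg (wccH_nonneg x l n) (Nat.cast_nonneg l)⟩
  have ba : ∀ l : ℕ, IsBoundedUnder (· ≤ ·) atTop (fun n => wccH x l n / l) := fun l =>
    isBoundedUnder_of ⟨(∑ w : Fin l → Bool, 2) / l, fun n =>
      div_le_div_of_nonneg_right (wccH_le x l n) (Nat.cast_nonneg l)⟩
  have hlow : ∀ l : ℕ, L ≤ liminf (fun n => slidingH x n (l + 1)) atTop := by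
    intro l
    rw [e1]
    apply le_of_forall_lt
    intro a ha
    obtain ⟨b, hab, hbL⟩ := exists_between ha
    refine lt_of_lt_of_le hab (le_liminf_of_le (ba (l + 1)).isCoboundedUnder_ge ?_)
    refine Filter.mem_iff_ultrafilter.2 fun U hU => ?_
    have ht := (wccH_tendsto x U (l + 1)).div_const ((l + 1 : ℕ) : ℝ)
    filter_upwards [ht.eventually (lt_mem_nhds (hbL.trans_le (hge U hU (l + 1) (by simp))))] with n hn
    exact hn.le
  have hhigh : ∀ l : ℕ, limsup (fun n => slidingH x n (l + 1)) atTop ≤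
      measH ν (l + 1) / ((l + 1 : ℕ) : ℝ) + 9 / ((l + 1 : ℕ) : ℝ) := by
    intro l
    rw [e2, ← add_div]
    refine limsup_le_of_le (bb (l + 1)).isCoboundedUnder_le ?_
    refine Filter.mem_iff_ultrafilter.2 fun U hU => ?_
    have hlt : wccE (wccQ x U) (l + 1) < measH ν (l + 1) + 9 := by
      have := abs_le.1 (hdiff U hU (l + 1)); linarith [this.2]
    filter_upwards [(wccH_tendsto x U (l + 1)).eventually (gt_mem_nhds hlt)] with n hn
    exact div_le_div_of_nonneg_right hn.le (Nat.cast_nonneg _)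
  have hmid : ∀ l : ℕ, liminf (fun n => slidingH x n (l + 1)) atTop ≤
      limsup (fun n => slidingH x n (l + 1)) atTop := fun l => by
    rw [e1, e2]; exact liminf_le_limsup (ba _) (bb _)
  have d1 : L ≤ dimFS x := le_ciInf hlow
  have d2 : dimFS x ≤ DimFS x :=
    ciInf_mono ⟨L, by rintro _ ⟨l, rfl⟩; exact hlow l⟩ hmid
  have d3 : DimFS x ≤ L := by
    have ht : Tendsto (fun n : ℕ => measH ν n / n + 9 / n) atTop (𝓝 (L + 0)) :=
      hL.add (tendsto_const_div_atTop_nhds_zero_nat 9)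
    rw [add_zero] at ht
    refine ge_of_tendsto' (ht.comp (tendsto_add_atTop_nat 1)) fun l => ?_
    refine le_trans (ciInf_le ⟨L, ?_⟩ l) (hhigh l)
    rintro _ ⟨l, rfl⟩; exact (hlow l).trans (hmid l)
  refine ⟨by linarith, by linarith, by linarith⟩
/-! ### evaluation and dyadic intervals -/

theorem wcc_term_le (x : Cantor) (i : ℕ) :
    (if x i then ((2:ℝ) ^ (i + 1))⁻¹ else 0) ≤ (1 / 2 / 2 ^ i : ℝ) := by
  have : ((2:ℝ) ^ (i + 1))⁻¹ = 1 / 2 / 2 ^ i := by rw [pow_succ]; field_simp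
  rw [this]
  split_ifs
  · exact le_rfl
  · positivity

theorem wcc_term_nonneg (x : Cantor) (i : ℕ) :
    0 ≤ (if x i then ((2:ℝ) ^ (i + 1))⁻¹ else 0) := by
  split_ifs <;> positivity

theorem wcc_summable (x : Cantor) :
    Summable fun i : ℕ => if x i then ((2:ℝ) ^ (i + 1))⁻¹ else 0 :=
  Summable.of_nonneg_of_le (wcc_term_nonneg x) (wcc_term_le x) (summable_geometric_two' 1)

theorem wcc_eval_mem (x : Cantor) : eval x ∈ Set.Icc (0 : ℝ) 1 := by
  refine ⟨tsum_nonneg (wcc_term_nonneg x), ?_⟩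
  rw [← tsum_geometric_two' 1]
  exact (wcc_summable x).tsum_le_tsum (wcc_term_le x) (summable_geometric_two' 1)

theorem wcc_eval_step (x : Cantor) :
    eval x = (if x 0 then 1 / 2 else 0) + eval (fun i => x (i + 1)) / 2 := by
  unfold eval
  rw [(wcc_summable x).tsum_eq_zero_add, ← tsum_div_const]
  congr 1
  · simp
  · refine tsum_congr fun i => ?_
    split_ifs
    · rw [pow_succ _ (i + 1)]; field_simp
    · simp

theorem wcc_val2_step (l : ℕ) (w : Fin (l + 1) → Bool) :
    val2 (l + 1) w = (if w 0 then 1 / 2 else 0) + val2 l (fun j => w j.succ) / 2 := by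
  unfold val2
  rw [Fin.sum_univ_succ, Finset.sum_div]
  congr 1
  · simp
  · refine Finset.sum_congr rfl fun i _ => ?_
    split_ifs
    · rw [Fin.val_succ, pow_succ _ ((i : ℕ) + 1)]; field_simp
    · simp

theorem wcc_val2_nonneg (l : ℕ) (w : Fin l → Bool) : 0 ≤ val2 l w :=
  Finset.sum_nonneg fun i _ => by split_ifs <;> positivity

theorem wcc_val2_le (l : ℕ) (w : Fin l → Bool) : val2 l w + ((2:ℝ) ^ l)⁻¹ ≤ 1 := by
  induction l with
  | zero => simp [val2]
  | succ l ih =>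
    have := ih (fun j => w j.succ)
    rw [wcc_val2_step, pow_succ, mul_inv]
    split_ifs <;> linarith

theorem wcc_val2_pos (l : ℕ) (w : Fin l → Bool) (h : ∃ j, w j = true) : 0 < val2 l w := by
  obtain ⟨j, hj⟩ := h
  refine Finset.sum_pos' (fun i _ => by split_ifs <;> positivity) ⟨j, Finset.mem_univ _, ?_⟩
  simp [hj]

theorem wcc_val2_lt (l : ℕ) (w : Fin l → Bool) (h : ∃ j, w j = false) :
    val2 l w + ((2:ℝ) ^ l)⁻¹ < 1 := by
  have h1 := wcc_val2_pos l (fun j => ! w j) (by obtain ⟨j, hj⟩ := h; exact ⟨j, by simp [hj]⟩)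
  have h2 : val2 l w + val2 l (fun j => ! w j) = val2 l (fun _ => true) := by
    unfold val2
    rw [← Finset.sum_add_distrib]
    refine Finset.sum_congr rfl fun i _ => ?_
    cases hw : w i <;> simp [hw]
  have h3 := wcc_val2_le l (fun _ => true)
  linarith

theorem wcc_val2_int (l : ℕ) (w : Fin l → Bool) : ∃ a : ℤ, (2:ℝ) ^ l * val2 l w = a := by
  induction l with
  | zero => exact ⟨0, by simp [val2]⟩
  | succ l ih =>
    obtain ⟨a, ha⟩ := ih (fun j => w j.succ)
    rw [wcc_val2_step]
    refine ⟨(if w 0 then 2 ^ l else 0) + a, ?_⟩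
    push_cast
    rw [← ha]
    split_ifs <;> ring

theorem wcc_cyl_icc (l : ℕ) (w : Fin l → Bool) (y : Cantor) (hy : ∀ j : Fin l, y (j : ℕ) = w j) :
    eval y ∈ Set.Icc (val2 l w) (val2 l w + ((2:ℝ) ^ l)⁻¹) := by
  induction l generalizing y with
  | zero => simpa [val2] using wcc_eval_mem y
  | succ l ih =>
    have := ih (fun j => w j.succ) (fun i => y (i + 1)) (fun j => by simpa using hy j.succ)
    rw [wcc_val2_step, wcc_eval_step, pow_succ, mul_inv]
    have h0 : y 0 = w 0 := by simpa using hy 0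
    rw [h0]
    constructor <;> linarith [this.1, this.2]

theorem wcc_ioo_cyl (l : ℕ) (w : Fin l → Bool) (y : Cantor)
    (hy : eval y ∈ Set.Ioo (val2 l w) (val2 l w + ((2:ℝ) ^ l)⁻¹)) (j : Fin l) :
    y (j : ℕ) = w j := by
  induction l generalizing y with
  | zero => exact j.elim0
  | succ l ih =>
    have h1 := wcc_val2_nonneg l (fun j => w j.succ)
    have h2 := wcc_val2_le l (fun j => w j.succ)
    have h3 := wcc_eval_mem (fun i => y (i + 1))
    rw [wcc_val2_step, wcc_eval_step, pow_succ, mul_inv] at hy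
    have h0 : y 0 = w 0 := by
      cases hy0 : y 0 <;> cases hw0 : w 0 <;> simp [hy0, hw0] at hy ⊢ <;>
        linarith [hy.1, hy.2, h3.1, h3.2]
    rw [h0] at hy
    refine Fin.cases (by simpa using h0) (fun j => ?_) j
    have := ih (fun j => w j.succ) (fun i => y (i + 1)) (by
      constructor <;> linarith [hy.1, hy.2]) j
    simpa using this

/-! ### measures on the circle -/

theorem wcc_ext (μ ν : Measure UnitAddCircle) [IsProbabilityMeasure μ] [IsProbabilityMeasure ν]
    (h : ∀ k : ℤ, ∫ y, fourier k y ∂μ = ∫ y, fourier k y ∂ν) : μ = ν := by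
  have hintg : ∀ (f : C(UnitAddCircle, ℂ)) (ρ : Measure UnitAddCircle) [IsProbabilityMeasure ρ],
      Integrable f ρ := fun f ρ _ =>
    (BoundedContinuousFunction.mkOfCompact f).integrable ρ
  have hspan : ∀ f ∈ Submodule.span ℂ (Set.range (@fourier 1)),
      ∫ y, (f : C(UnitAddCircle, ℂ)) y ∂μ = ∫ y, f y ∂ν := by
    intro f hf
    induction hf using Submodule.span_induction with
    | mem f hf => obtain ⟨k, rfl⟩ := hf; exact h k
    | zero => simp
    | add f g _ _ hf hg =>
      simp only [ContinuousMap.add_apply]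
      rw [integral_add (hintg f μ) (hintg g μ), integral_add (hintg f ν) (hintg g ν), hf, hg]
    | smul a f _ hf =>
      simp only [ContinuousMap.smul_apply]
      rw [integral_smul, integral_smul, hf]
  have hall : ∀ f : C(UnitAddCircle, ℂ), ∫ y, f y ∂μ = ∫ y, f y ∂ν := by
    intro f
    have hf : f ∈ (Submodule.span ℂ (Set.range (@fourier 1))).topologicalClosure := by
      rw [span_fourier_closure_eq_top]; trivial
    have hf' : f ∈ closure (Submodule.span ℂ (Set.range (@fourier 1)) : Set C(UnitAddCircle, ℂ)) := hf
    rw [Metric.mem_closure_iff] at hf'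
    apply eq_of_forall_dist_le
    intro ε hε
    obtain ⟨g, hg, hd⟩ := hf' (ε / 2) (by positivity)
    have hb : ∀ (ρ : Measure UnitAddCircle) [IsProbabilityMeasure ρ],
        dist (∫ y, f y ∂ρ) (∫ y, g y ∂ρ) ≤ ε / 2 := by
      intro ρ _
      rw [dist_eq_norm, ← integral_sub (hintg f ρ) (hintg g ρ)]
      have := norm_integral_le_of_norm_le_const (μ := ρ) (f := fun y => f y - g y) (C := ε / 2)
        (Eventually.of_forall fun y => by
          rw [← dist_eq_norm]; exact (ContinuousMap.dist_apply_le_dist y).trans hd.le)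
      simpa using this
    have h1 := hb μ
    have h2 := hb ν
    rw [← hspan g hg] at h2
    calc _ ≤ _ := dist_triangle_right _ _ (∫ y, g y ∂μ)
      _ ≤ ε := by linarith
  apply ext_of_forall_integral_eq_of_IsFiniteMeasure
  intro f
  have := hall ⟨fun y => (f y : ℂ), by fun_prop⟩
  simp only [ContinuousMap.coe_mk] at this
  have e : ∀ ρ : Measure UnitAddCircle, ∫ y, ((f y : ℝ) : ℂ) ∂ρ = ((∫ y, f y ∂ρ : ℝ) : ℂ) :=
    fun ρ => integral_ofReal (𝕜 := ℂ)
  rw [e, e] at this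
  exact_mod_cast this

def wccPt (x : Cantor) (j : ℕ) : UnitAddCircle := ((eval (shiftk x j) : ℝ) : UnitAddCircle)

def wccEmpM (x : Cantor) (n : ℕ) : Measure UnitAddCircle :=
  ((n + 1 : ℕ) : ℝ≥0∞)⁻¹ • ∑ j ∈ Finset.range (n + 1), Measure.dirac (wccPt x j)

instance wccEmpM_prob (x : Cantor) (n : ℕ) : IsProbabilityMeasure (wccEmpM x n) := by
  constructor
  unfold wccEmpM
  simp only [Measure.smul_apply, Measure.finsetSum_apply, measure_univ, Finset.sum_const,
    Finset.card_range, nsmul_eq_mul, mul_one, smul_eq_mul]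
  exact ENNReal.inv_mul_cancel (by simp) (ENNReal.natCast_ne_top _)

/-- the empirical measure of the first `n` points (junk at `n = 0`) -/
def wccEmp (x : Cantor) (n : ℕ) : ProbabilityMeasure UnitAddCircle := ⟨wccEmpM x (n - 1), inferInstance⟩

theorem wccEmp_integral (x : Cantor) {n : ℕ} (hn : n ≠ 0) (f : C(UnitAddCircle, ℂ)) :
    ∫ y, f y ∂(wccEmp x n : Measure UnitAddCircle) =
      (n : ℂ)⁻¹ * ∑ j ∈ Finset.range n, f (wccPt x j) := by
  obtain ⟨m, rfl⟩ := Nat.exists_eq_succ_of_ne_zero hn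
  change ∫ y, f y ∂(wccEmpM x m) = _
  unfold wccEmpM
  rw [integral_smul_measure, integral_finsetSum_measure]
  · simp only [integral_dirac, ENNReal.toReal_inv, ENNReal.toReal_natCast]
    rw [Complex.real_smul]
    push_cast
    rfl
  · intro i _
    exact (BoundedContinuousFunction.mkOfCompact f).integrable _

theorem wccEmp_real (x : Cantor) {n : ℕ} (hn : n ≠ 0) (S : Set UnitAddCircle) (hS : MeasurableSet S) :
    ((wccEmp x n : Measure UnitAddCircle) S).toReal =
      (∑ j ∈ Finset.range n, S.indicator (fun _ => (1 : ℝ)) (wccPt x j)) / n := by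
  obtain ⟨m, rfl⟩ := Nat.exists_eq_succ_of_ne_zero hn
  change (wccEmpM x m S).toReal = _
  unfold wccEmpM
  simp only [Measure.smul_apply, Measure.finsetSum_apply, smul_eq_mul, ENNReal.toReal_mul,
    ENNReal.toReal_inv, ENNReal.toReal_natCast, Measure.dirac_apply' _ hS]
  rw [ENNReal.toReal_sum (fun i _ => by
    by_cases h : wccPt x i ∈ S <;> simp [h])]
  rw [div_eq_inv_mul]
  congr 2
  funext i
  by_cases h : wccPt x i ∈ S <;> simp [h]

theorem wcc_weyl (x : Cantor) {n : ℕ} (hn : n ≠ 0) (k : ℤ) :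
    ∫ y, fourier k y ∂(wccEmp x n : Measure UnitAddCircle) = weylAvg x k n := by
  rw [wccEmp_integral x hn]
  unfold weylAvg wccPt
  simp [fourier_coe_apply, -fourier_apply]

theorem wcc_compact (x : Cantor) (c : ℤ → ℂ)
    (h : ∀ k : ℤ, Tendsto (weylAvg x k) atTop (𝓝 (c k))) (U : Ultrafilter ℕ)
    (hU : (U : Filter ℕ) ≤ atTop) :
    ∃ μ : ProbabilityMeasure UnitAddCircle, Tendsto (wccEmp x) U (𝓝 μ) ∧
      ∀ k : ℤ, ∫ y, fourier k y ∂(μ : Measure UnitAddCircle) = c k := by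
  obtain ⟨μ, -, hμ⟩ := (isCompact_univ (X := ProbabilityMeasure UnitAddCircle)).ultrafilter_le_nhds
    (U.map (wccEmp x)) (by simp)
  have hμ' : Tendsto (wccEmp x) U (𝓝 μ) := hμ
  refine ⟨μ, hμ', fun k => ?_⟩
  have h1 := (ProbabilityMeasure.tendsto_iff_forall_integral_rclike_tendsto ℂ).1 hμ'
    (BoundedContinuousFunction.mkOfCompact (fourier k))
  refine tendsto_nhds_unique h1 (((h k).mono_left hU).congr' ?_)
  filter_upwards [hU (eventually_ne_atTop 0)] with n hn
  exact (wcc_weyl x hn k).symm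

theorem wccPt_succ (x : Cantor) (j : ℕ) : wccPt x (j + 1) = (2 : ℕ) • wccPt x j := by
  unfold wccPt
  rw [wcc_eval_step (shiftk x j)]
  have : (fun i => shiftk x j (i + 1)) = shiftk x (j + 1) := by
    funext i; simp [shiftk]; congr 1; ring
  rw [this, ← AddCircle.coe_nsmul]
  split_ifs
  · have : (2 : ℕ) • (1 / 2 + eval (shiftk x (j + 1)) / 2) = 1 + eval (shiftk x (j + 1)) := by
      simp; ring
    rw [this, AddCircle.coe_add, AddCircle.coe_period, zero_add]
  · congr 1; simp; ring

theorem wcc_fourier_two (k : ℤ) (y : UnitAddCircle) :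
    fourier k ((2 : ℕ) • y) = fourier (2 * k) y := by
  rw [fourier_apply, fourier_apply]
  congr 2
  rw [← natCast_zsmul, ← mul_zsmul]
  congr 1; push_cast; ring

theorem wcc_c_two (x : Cantor) (c : ℤ → ℂ)
    (h : ∀ k : ℤ, Tendsto (weylAvg x k) atTop (𝓝 (c k))) (k : ℤ) : c (2 * k) = c k := by
  have h0 : Tendsto (fun n => weylAvg x (2 * k) n - weylAvg x k n) atTop (𝓝 0) := by
    refine squeeze_zero_norm' (a := fun n : ℕ => (2 : ℝ) / n) ?_
      (tendsto_const_div_atTop_nhds_zero_nat 2)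
    filter_upwards [eventually_ne_atTop 0] with n hn
    rw [← wcc_weyl x hn, ← wcc_weyl x hn, wccEmp_integral x hn, wccEmp_integral x hn, ← mul_sub,
      ← Finset.sum_sub_distrib]
    simp_rw [← wcc_fourier_two, ← wccPt_succ]
    rw [Finset.sum_range_sub (fun j => fourier k (wccPt x j)), norm_mul, norm_inv,
      Complex.norm_natCast, div_eq_inv_mul]
    refine mul_le_mul_of_nonneg_left ((norm_sub_le _ _).trans ?_) (by positivity)
    have : ∀ y : UnitAddCircle, ‖fourier k y‖ = 1 := fun y => by
      rw [fourier_apply]; exact Circle.norm_coe _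
    rw [this, this]; norm_num
  exact sub_eq_zero.1 (tendsto_nhds_unique ((h (2 * k)).sub (h k)) h0)

theorem wcc_inv (μ : Measure UnitAddCircle) [IsProbabilityMeasure μ]
    (h : ∀ k : ℤ, ∫ y, fourier (2 * k) y ∂μ = ∫ y, fourier k y ∂μ) :
    μ.map (fun y => (2 : ℕ) • y) = μ := by
  have hm : Continuous fun y : UnitAddCircle => (2 : ℕ) • y := continuous_nsmul 2
  haveI : IsProbabilityMeasure (μ.map (fun y => (2 : ℕ) • y)) :=
    Measure.isProbabilityMeasure_map hm.measurable.aemeasurable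
  refine wcc_ext _ _ fun k => ?_
  rw [integral_map hm.measurable.aemeasurable (fourier k).continuous.aestronglyMeasurable, ← h k]
  simp_rw [wcc_fourier_two]

theorem wcc_null (μ : Measure UnitAddCircle) [IsProbabilityMeasure μ]
    (h : μ.map (fun y => (2 : ℕ) • y) = μ) (l : ℕ) (y : UnitAddCircle) (hy : (2 ^ l : ℕ) • y = 0)
    (hy0 : y ≠ 0) : μ {y} = 0 := by
  have hm : Continuous fun y : UnitAddCircle => (2 : ℕ) • y := continuous_nsmul 2
  have hA : ∀ k : ℕ, MeasurableSet {y : UnitAddCircle | (2 ^ k : ℕ) • y = 0} := fun k =>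
    (isClosed_eq (continuous_nsmul _) continuous_const).measurableSet
  have hk : ∀ k : ℕ, μ {y | (2 ^ k : ℕ) • y = 0} = μ {0} := by
    intro k
    induction k with
    | zero => congr 1; ext; simp
    | succ k ih =>
      rw [← ih]
      conv_rhs => rw [← h]
      rw [Measure.map_apply hm.measurable (hA k)]
      congr 1; ext z; simp [pow_succ, mul_nsmul']
  have hsub : ({0} : Set UnitAddCircle) ∪ {y} ⊆ {y | (2 ^ l : ℕ) • y = 0} := by
    rintro z (rfl | rfl)
    · simp
    · exact hy
  have := measure_mono (μ := μ) hsub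
  rw [hk, measure_union (by simpa using hy0.symm) (measurableSet_singleton y)] at this
  by_contra h0
  exact absurd this (not_le.2 (ENNReal.lt_add_right (measure_ne_top _ _) h0))

theorem wcc_word (x : Cantor) (U : Ultrafilter ℕ) (hU : (U : Filter ℕ) ≤ atTop)
    (μ : ProbabilityMeasure UnitAddCircle)
    (hμ : Tendsto (wccEmp x) U (𝓝 μ))
    (hinv : (μ : Measure UnitAddCircle).map (fun y => (2 : ℕ) • y) = μ)
    (l : ℕ) (w : Fin l → Bool) (ht : ∃ j, w j = true) (hf : ∃ j, w j = false) :
    wccQ x U l w = ((μ : Measure UnitAddCircle) (IwT l w)).toReal := by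
  set a := val2 l w with ha
  set b := val2 l w + ((2:ℝ) ^ l)⁻¹ with hb
  have ha0 : 0 < a := wcc_val2_pos l w ht
  have hb1 : b < 1 := wcc_val2_lt l w hf
  have hab : a < b := by rw [hb]; have : (0:ℝ) < ((2:ℝ) ^ l)⁻¹ := by positivity
                         linarith
  set F : Set UnitAddCircle := (fun t : ℝ => (t : UnitAddCircle)) '' Set.Icc a b with hF
  set G : Set UnitAddCircle := (fun t : ℝ => (t : UnitAddCircle)) '' Set.Ioo a b with hG
  have hFc : IsClosed F := (isCompact_Icc.image (AddCircle.continuous_mk' 1)).isClosed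
  have hGo : IsOpen G := QuotientAddGroup.isOpenMap_coe _ isOpen_Ioo
  have hGI : G ⊆ IwT l w := Set.image_mono Set.Ioo_subset_Ico_self
  have hIF : IwT l w ⊆ F := Set.image_mono Set.Ico_subset_Icc_self
  have hne : ∀ t : ℝ, 0 < t → t < 1 → (t : UnitAddCircle) ≠ 0 := by
    intro t h0 h1 h
    rw [AddCircle.coe_eq_zero_iff] at h
    obtain ⟨n, hn⟩ := h
    simp at hn
    rw [← hn] at h0 h1
    have h0' : (0 : ℤ) < n := by exact_mod_cast h0
    have h1' : n < (1 : ℤ) := by exact_mod_cast h1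
    omega
  obtain ⟨z, hz⟩ := wcc_val2_int l w
  have hzero : ∀ (t : ℝ) (n : ℤ), (2:ℝ) ^ l * t = n → (2 ^ l : ℕ) • (t : UnitAddCircle) = 0 := by
    intro t n h
    rw [← AddCircle.coe_nsmul, AddCircle.coe_eq_zero_iff]
    exact ⟨n, by simp [h]⟩
  have na : (μ : Measure UnitAddCircle) {(a : UnitAddCircle)} = 0 :=
    wcc_null μ hinv l _ (hzero a z hz) (hne a ha0 (hab.trans hb1))
  have nb : (μ : Measure UnitAddCircle) {(b : UnitAddCircle)} = 0 :=
    wcc_null μ hinv l _ (hzero b (z + 1) (by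
      rw [hb, mul_add, hz, mul_inv_cancel₀ (by positivity)]; push_cast; ring))
      (hne b (ha0.trans hab) hb1)
  have hFG : F \ G ⊆ {(a : UnitAddCircle)} ∪ {(b : UnitAddCircle)} := by
    rintro _ ⟨⟨t, ht, rfl⟩, h2⟩
    rcases ht.1.eq_or_lt with h | h
    · left; rw [h]; rfl
    · rcases ht.2.eq_or_lt with h' | h'
      · right; rw [h']; rfl
      · exact absurd ⟨t, ⟨h, h'⟩, rfl⟩ h2
  have hnull : (μ : Measure UnitAddCircle) (F \ G) = 0 :=
    measure_mono_null hFG (measure_union_null na nb)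
  have hGF : G ⊆ F := hGI.trans hIF
  have hFr : (μ : Measure UnitAddCircle) (frontier F) = 0 := by
    refine measure_mono_null ?_ hnull
    rw [hFc.frontier_eq]
    exact Set.sdiff_subset_sdiff_right (interior_maximal hGF hGo)
  have hGr : (μ : Measure UnitAddCircle) (frontier G) = 0 := by
    refine measure_mono_null ?_ hnull
    rw [hGo.frontier_eq]
    exact Set.sdiff_subset_sdiff_left (closure_minimal hGF hFc)
  have eFG : (μ : Measure UnitAddCircle) F ≤ (μ : Measure UnitAddCircle) G := by
    calc _ = (μ : Measure UnitAddCircle) (G ∪ (F \ G)) := by rw [Set.union_sdiff_cancel hGF]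
      _ ≤ _ := measure_union_le _ _
      _ = _ := by rw [hnull, add_zero]
  have eF : (μ : Measure UnitAddCircle) F = (μ : Measure UnitAddCircle) (IwT l w) :=
    le_antisymm (eFG.trans (measure_mono hGI)) (measure_mono hIF)
  have eG : (μ : Measure UnitAddCircle) G = (μ : Measure UnitAddCircle) (IwT l w) :=
    le_antisymm (measure_mono hGI) ((measure_mono hIF).trans eFG)
  have tF := (ENNReal.tendsto_toReal (measure_ne_top _ _)).comp
    (ProbabilityMeasure.tendsto_measure_of_null_frontier_of_tendsto' hμ hFr)
  have tG := (ENNReal.tendsto_toReal (measure_ne_top _ _)).comp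
    (ProbabilityMeasure.tendsto_measure_of_null_frontier_of_tendsto' hμ hGr)
  rw [eF] at tF
  rw [eG] at tG
  have hadd : ∀ i (j : ℕ), x (i + j) = shiftk x i j := fun i j => by simp [shiftk, add_comm]
  have indF : ∀ i, wccInd x l w i ≤ F.indicator (fun _ => (1 : ℝ)) (wccPt x i) := by
    intro i
    unfold wccInd
    split_ifs with hi
    · have : wccPt x i ∈ F :=
        ⟨_, wcc_cyl_icc l w (shiftk x i) (fun j => by rw [← hadd]; exact hi j), rfl⟩
      simp [this]
    · exact Set.indicator_nonneg (fun _ _ => zero_le_one) _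
  have indG : ∀ i, G.indicator (fun _ => (1 : ℝ)) (wccPt x i) ≤ wccInd x l w i := by
    intro i
    by_cases hi : wccPt x i ∈ G
    · obtain ⟨t, ht, hti⟩ := hi
      have hti' : (t : UnitAddCircle) = ((eval (shiftk x i) : ℝ) : UnitAddCircle) := hti
      have hev := wcc_eval_mem (shiftk x i)
      have heq : eval (shiftk x i) = t := by
        have h3 : ((eval (shiftk x i) - t : ℝ) : UnitAddCircle) = 0 := by
          rw [AddCircle.coe_sub, hti', sub_self]
        rw [AddCircle.coe_eq_zero_iff] at h3
        obtain ⟨n, hn⟩ := h3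
        simp at hn
        have u1 : (n : ℝ) < 1 := by rw [hn]; linarith [hev.2, ht.1]
        have u2 : (-1 : ℝ) < n := by rw [hn]; linarith [hev.1, ht.2]
        have u1' : n < 1 := by exact_mod_cast u1
        have u2' : -1 < n := by exact_mod_cast u2
        have : n = 0 := by omega
        rw [this] at hn
        push_cast at hn; linarith
      have : ∀ j : Fin l, x (i + (j : ℕ)) = w j := fun j => by
        rw [hadd]; exact wcc_ioo_cyl l w _ (by rw [heq]; exact ht) j
      unfold wccInd
      rw [if_pos this]
      exact Set.indicator_le_self' (fun _ _ => zero_le_one) _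
    · rw [Set.indicator_of_notMem hi]; exact wccInd_nonneg _ _ _ _
  refine tendsto_nhds_unique (wccQ_tendsto x U l w) ?_
  refine tendsto_of_tendsto_of_tendsto_of_le_of_le' tG tF ?_ ?_
  · filter_upwards [hU (eventually_ne_atTop 0)] with n hn
    simp only [Function.comp]
    rw [wccEmp_real x hn G hGo.measurableSet]
    exact div_le_div_of_nonneg_right (Finset.sum_le_sum fun i _ => indG i) (Nat.cast_nonneg n)
  · filter_upwards [hU (eventually_ne_atTop 0)] with n hn
    simp only [Function.comp]
    rw [wccEmp_real x hn F hFc.measurableSet]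
    exact div_le_div_of_nonneg_right (Finset.sum_le_sum fun i _ => indF i) (Nat.cast_nonneg n)

/-- convergent Weyl averages give a unique limit measure on the torus whose
lifted average entropies equal the (coinciding) finite-state dimensions of x. -/
theorem weyl_criterion_convergent_case
    (x : Cantor) (c : ℤ → ℂ)
    (h : ∀ k : ℤ, Tendsto (weylAvg x k) atTop (nhds (c k))) :
    (∃! μ : Measure UnitAddCircle,
        IsProbabilityMeasure μ ∧ ∀ k : ℤ, ∫ y, fourier k y ∂μ = c k) ∧
    (∀ μ : Measure UnitAddCircle, IsProbabilityMeasure μ →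
      (∀ k : ℤ, ∫ y, fourier k y ∂μ = c k) →
      ∀ ν : Measure Cantor, IsProbabilityMeasure ν →
        (∀ (l : ℕ) (w : Fin l → Bool), ν (Cyl l w) = μ (IwT l w)) →
        dimFS x = DimFS x ∧ dimFS x = Hminus ν ∧ Hminus ν = Hplus ν) := by
  refine ⟨?_, ?_⟩
  · obtain ⟨μ, -, hμ⟩ := wcc_compact x c h (Ultrafilter.of atTop) (Ultrafilter.of_le atTop)
    refine ⟨μ, ⟨inferInstance, hμ⟩, ?_⟩
    rintro μ' ⟨h1, h2⟩
    haveI := h1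
    exact wcc_ext _ _ fun k => by rw [h2, hμ]
  · intro μ hμ hc ν hν hνμ
    have hinv : μ.map (fun y => (2 : ℕ) • y) = μ :=
      wcc_inv μ fun k => by rw [hc, hc, wcc_c_two x c h]
    refine wcc_abstract x ν fun U hU l w ht hf => ?_
    rw [hνμ]
    obtain ⟨μ', hμ', hc'⟩ := wcc_compact x c h U hU
    have e : (μ' : Measure UnitAddCircle) = μ := wcc_ext _ _ fun k => by rw [hc, hc']
    rw [← e]
    exact wcc_word x U hU μ' hμ' (by rw [e]; exact hinv) l w ht hf

end
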